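/- arXiv:0809.4443 — 2 statements merged into one kernel-verified Lean document; each statement's English description precedes it below -/
import Mathlib

section
/- Let k be an infinite field of characteristic 2 and let a, b, c be pairwise distinct powers of 2. Then there is no polynomial β ∈ k[x,y] with β(0,y) = β(x,0) = 0 such that δ²(β)(z₁,z₂,z₃) = z₁^a · z₂^b · z₃^c for all z₁, z₂, z₃ ∈ k. -/
/-- The second coboundary operator on 2-cochains for the additive group. -/
def delta2 {k : Type*} [CommRing k] (β : k × k → k) (z₁ z₂ z₃ : k) : k :=
  β (z₁, z₂) + β (z₁ + z₂, z₃) - β (z₂, z₃) - β (z₁, z₂ + z₃)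

/-- Over an infinite field of characteristic 2, if `a, b, c` are pairwise distinct
powers of 2, then no polynomial `β ∈ k[x,y]` vanishing on the axes satisfies
`δ²(β)(z₁,z₂,z₃) = z₁^a z₂^b z₃^c`. -/
theorem no_polynomial_cochain_char_two (k : Type*) [Field k] [CharP k 2] [Infinite k]
    (u v w : ℕ) (a b c : ℕ) (ha : a = 2 ^ u) (hb : b = 2 ^ v) (hc : c = 2 ^ w)
    (hab : a ≠ b) (hac : a ≠ c) (hbc : b ≠ c) :
    ¬ ∃ β : MvPolynomial (Fin 2) k,
        (∀ y : k, MvPolynomial.eval ![0, y] β = 0) ∧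
        (∀ x : k, MvPolynomial.eval ![x, (0 : k)] β = 0) ∧
        (∀ z₁ z₂ z₃ : k,
          delta2 (fun z : k × k => MvPolynomial.eval ![z.1, z.2] β) z₁ z₂ z₃
            = z₁ ^ a * z₂ ^ b * z₃ ^ c) := by
  rintro ⟨β, -, -, h⟩
  have key : ∀ x y z : k,
      x ^ a * y ^ b * z ^ c + y ^ a * z ^ b * x ^ c + z ^ a * x ^ b * y ^ c
      - y ^ a * x ^ b * z ^ c - x ^ a * z ^ b * y ^ c - z ^ a * y ^ b * x ^ c = 0 := by
    intro x y z
    rw [← h x y z, ← h y z x, ← h z x y, ← h y x z, ← h x z y, ← h z y x]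
    simp only [delta2]
    rw [add_comm y x, add_comm z x, add_comm z y]
    ring
  have key2 : ∀ y z : k, y ^ b * z ^ c - z ^ b * y ^ c = 0 := by
    intro y z
    have hp : (Polynomial.C (y ^ b * z ^ c - z ^ b * y ^ c) * Polynomial.X ^ a
        + Polynomial.C (z ^ a * y ^ c - y ^ a * z ^ c) * Polynomial.X ^ b
        + Polynomial.C (y ^ a * z ^ b - z ^ a * y ^ b) * Polynomial.X ^ c
        : Polynomial k) = 0 := by
      apply Polynomial.funext
      intro x
      have := key x y z
      simp only [Polynomial.eval_add, Polynomial.eval_mul, Polynomial.eval_C,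
        Polynomial.eval_pow, Polynomial.eval_X, Polynomial.eval_zero]
      linear_combination this
    have := congrArg (fun p => Polynomial.coeff p a) hp
    simpa only [Polynomial.coeff_add, Polynomial.coeff_C_mul, Polynomial.coeff_X_pow, hab, hac,
      if_true, if_false, mul_one, mul_zero, add_zero, Polynomial.coeff_zero] using this
  have hq : (Polynomial.X ^ b : Polynomial k) = Polynomial.X ^ c := by
    apply Polynomial.funext
    intro x
    have := key2 x 1
    simp only [Polynomial.eval_pow, Polynomial.eval_X]
    simp only [one_pow, mul_one, one_mul] at this
    linear_combination this
  have := congrArg (fun p => Polynomial.coeff p b) hq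
  simp [Polynomial.coeff_X_pow, hbc] at this
end

section
/- Let k be a field with at least 3 elements and let the group G on k³ have product (x₁,x₂,x₃)·(y₁,y₂,y₃) = (x₁ + y₁ + y₂^{h₂}x₃^{h₃}, x₂ + y₂, x₃ + y₃), where h₂, h₃ are positive integers such that t ↦ t^{h₂} and t ↦ t^{h₃} are injective additive maps of k. Then the center of G is exactly {(t,0,0) : t ∈ k}. -/
/-- For the group on `k³` with product
`(x₁,x₂,x₃)·(y₁,y₂,y₃) = (x₁+y₁+y₂^{h₂}x₃^{h₃}, x₂+y₂, x₃+y₃)` over a field `k`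
with at least 3 elements, the center is exactly `{(t,0,0) : t ∈ k}`. -/
theorem center_of_unipotent_group (k : Type*) [Field k] (hcard : 3 ≤ Cardinal.mk k)
    (h₂ h₃ : ℕ) (hh₂ : 0 < h₂) (hh₃ : 0 < h₃)
    (hadd₂ : ∀ x y : k, (x + y) ^ h₂ = x ^ h₂ + y ^ h₂)
    (hadd₃ : ∀ x y : k, (x + y) ^ h₃ = x ^ h₃ + y ^ h₃)
    (hinj₂ : Function.Injective fun t : k => t ^ h₂)
    (hinj₃ : Function.Injective fun t : k => t ^ h₃)
    (mul : k × k × k → k × k × k → k × k × k)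
    (hmul : ∀ x y : k × k × k, mul x y =
      (x.1 + y.1 + y.2.1 ^ h₂ * x.2.2 ^ h₃, x.2.1 + y.2.1, x.2.2 + y.2.2)) :
    ∀ x : k × k × k, (∀ y : k × k × k, mul x y = mul y x) ↔ x.2.1 = 0 ∧ x.2.2 = 0 := by
  rintro ⟨a, b, c⟩
  constructor
  · intro h
    have e1 := congrArg Prod.fst (h (0, 1, 0))
    have e2 := congrArg Prod.fst (h (0, 0, 1))
    simp [hmul, hh₂.ne', hh₃.ne'] at e1 e2
    exact ⟨e2, e1⟩
  · rintro ⟨hb, hc⟩ ⟨y1, y2, y3⟩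
    simp only at hb hc
    subst hb hc
    simp [hmul, hh₂.ne', hh₃.ne', add_comm]
end
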